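/- Let $A$ be a commutative ring, $I \subseteq A$ an ideal, and $B$ a flat $A$-module. Then for every $A/I$-module $M$ (i.e. every $A$-module $M$ with $IM = 0$) and every $p \ge 0$ there is an isomorphism $\mathrm{Ext}^p_A(B, M) \cong \mathrm{Ext}^p_{A/I}(B/IB, M)$. -/

import Mathlib

open CategoryTheory

/-- In a short exact sequence `0 → M → N → P → 0` with `N` and `P` flat, `M` is flat. -/
lemma Module.Flat.of_exact_of_flat {R M N P : Type*} [CommRing R] [AddCommGroup M]
    [AddCommGroup N] [AddCommGroup P] [Module R M] [Module R N] [Module R P] [Module.Flat R N]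
    [Module.Flat R P] (g : M →ₗ[R] N) (f : N →ₗ[R] P) (hg : Function.Injective g)
    (hf : Function.Surjective f) (H : Function.Exact g f) : Module.Flat R M := by
  rw [Module.Flat.iff_rTensor_preserves_injective_linearMap]
  intro X Y _ _ _ _ h hh
  have h₁ : Function.Injective (h.rTensor N ∘ₗ g.lTensor X) :=
    (Module.Flat.rTensor_preserves_injective_linearMap h hh).comp
      (LinearMap.lTensor_injective_of_exact_of_flat f hf g hg H X)
  rw [LinearMap.rTensor_comp_lTensor, ← LinearMap.lTensor_comp_rTensor] at h₁
  exact Function.Injective.of_comp h₁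

section

variable {R M₁ M₂ M₃ : Type*} [CommRing R] [AddCommGroup M₁]
    [AddCommGroup M₂] [AddCommGroup M₃] [Module R M₁] [Module R M₂] [Module R M₃]
    {f : M₁ →ₗ[R] M₂} {g : M₂ →ₗ[R] M₃}

/-- Tensoring preserves exactness of `M₁ → M₂ → M₃` when the cokernel of `M₂ → M₃` is flat. -/
lemma LinearMap.lTensor_exact_of_flat_quotient_range (H : Function.Exact f g)
    [Module.Flat R (M₃ ⧸ LinearMap.range g)] (A : Type*) [AddCommGroup A] [Module R A] :
    Function.Exact (f.lTensor A) (g.lTensor A) := by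
  have hi : Function.Injective ((LinearMap.range g).subtype.lTensor A) :=
    LinearMap.lTensor_injective_of_exact_of_flat (LinearMap.range g).mkQ
      (Submodule.mkQ_surjective _) _ (Submodule.subtype_injective _)
      (LinearMap.exact_subtype_mkQ _) A
  have he : Function.Exact f g.rangeRestrict := fun x => by
    rw [← H x, Subtype.ext_iff]; rfl
  have := (lTensor_exact A he g.surjective_rangeRestrict).comp_injective _ hi (map_zero _)
  rwa [← LinearMap.coe_comp, ← LinearMap.lTensor_comp, LinearMap.subtype_comp_codRestrict] at this

lemma Module.Flat.quotient_range_of_exact (H : Function.Exact f g) [Module.Flat R M₃]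
    [Module.Flat R (M₃ ⧸ LinearMap.range g)] : Module.Flat R (M₂ ⧸ LinearMap.range f) := by
  have : Module.Flat R (LinearMap.range g) :=
    .of_exact_of_flat _ (LinearMap.range g).mkQ (Submodule.subtype_injective _)
      (Submodule.mkQ_surjective _) (LinearMap.exact_subtype_mkQ _)
  exact .of_linearEquiv ((Submodule.quotEquivOfEq _ _ H.linearMap_ker_eq.symm).trans
    g.quotKerEquivRange)

end

namespace ModuleCat

universe u
variable {R S : Type u} [CommRing R] [CommRing S] (f : R →+* S)

instance : (extendScalars.{u, u, u} f).Additive :=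
  (extendRestrictScalarsAdj f).left_adjoint_additive

/-- The extension-restriction of scalars adjunction, as an `R`-linear equivalence on Hom modules. -/
noncomputable def extendScalarsHomLinearEquiv (X : ModuleCat.{u} R) (Y : ModuleCat.{u} S) :
    (restrictScalars f).obj
        (ModuleCat.of S ((extendScalars.{u, u, u} f).obj X ⟶ Y)) ≃ₗ[R]
      (X ⟶ (restrictScalars f).obj Y) :=
  { (extendRestrictScalarsAdj f).homAddEquiv X Y with
    map_smul' _ _ := rfl }

end ModuleCat

namespace CategoryTheory.ProjectiveResolution

universe u
variable {R : Type u} [CommRing R] {X : ModuleCat.{u} R} (P : ProjectiveResolution X)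

/-- The cokernels of the differentials in a projective resolution of a flat module are flat. -/
lemma flat_quotient_range_d [Module.Flat R X] (n : ℕ) :
    Module.Flat R (P.complex.X n ⧸ LinearMap.range (P.complex.d (n + 1) n).hom) := by
  induction n with
  | zero =>
    have hX := (ShortComplex.ShortExact.moduleCat_exact_iff_function_exact _).1 P.exact₀
    have hs := (ModuleCat.epi_iff_surjective (P.π.f 0)).1 inferInstance
    have : Module.Flat R (((ChainComplex.single₀ (ModuleCat.{u} R)).obj X).X 0) :=
      inferInstanceAs (Module.Flat R X)
    exact .of_linearEquiv ((Submodule.quotEquivOfEq _ _ hX.linearMap_ker_eq.symm).trans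
      ((P.π.f 0).hom.quotKerEquivOfSurjective hs))
  | succ n ih =>
    have : Module.Flat R (P.complex.X n) :=
      have := (IsProjective.iff_projective (P.complex.X n)).2 (P.projective n)
      inferInstance
    exact .quotient_range_of_exact
      ((ShortComplex.ShortExact.moduleCat_exact_iff_function_exact _).1 (P.exact_succ n))

variable {S : Type u} [CommRing S] (f : R →+* S)

/-- Extension of scalars sends a projective resolution of a flat module to a projective
resolution. -/
noncomputable def extendScalars [Module.Flat R X] :
    ProjectiveResolution ((ModuleCat.extendScalars.{u, u, u} f).obj X) where
  complex := ((ModuleCat.extendScalars f).mapHomologicalComplex _).obj P.complex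
  projective n := (ModuleCat.extendRestrictScalarsAdj f).map_projective _ (P.projective n)
  π := (ChainComplex.toSingle₀Equiv _ _).symm ⟨(ModuleCat.extendScalars f).map (P.π.f 0), by
    exact ((ModuleCat.extendScalars f).map_comp _ _).symm.trans
      ((congrArg _ P.complex_d_comp_π_f_zero).trans ((ModuleCat.extendScalars f).map_zero _ _))⟩
  quasiIso := ⟨fun n => by
    cases n with
    | zero =>
      rw [ChainComplex.quasiIsoAt₀_iff, ShortComplex.quasiIso_iff_of_zeros' _
        (((ModuleCat.extendScalars.{u, u, u} f).mapHomologicalComplex _).obj P.complex |>.shape 0 0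
          (by simp)) rfl rfl]
      have := (ModuleCat.extendRestrictScalarsAdj.{u, u, u} f).isLeftAdjoint
      constructor
      · exact P.exact₀.map_of_epi_of_preservesCokernel
          (ModuleCat.extendScalars.{u, u, u} f) inferInstance inferInstance
      · exact (ModuleCat.extendScalars.{u, u, u} f).map_epi (P.π.f 0)
    | succ n =>
      rw [quasiIsoAt_iff_exactAt' _ _ (ChainComplex.exactAt_succ_single_obj _ _),
        HomologicalComplex.exactAt_iff' _ (n + 2) (n + 1) n (by simp only [ChainComplex.prev]; rfl)
          (by simp)]
      have := P.flat_quotient_range_d n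
      algebraize [f]
      rw [ShortComplex.ShortExact.moduleCat_exact_iff_function_exact]
      exact LinearMap.lTensor_exact_of_flat_quotient_range
        ((ShortComplex.ShortExact.moduleCat_exact_iff_function_exact _).1 (P.exact_succ n)) S⟩

/-- The Hom complex from `P` into a restriction of scalars is the Hom complex from the extension of
scalars of `P`. -/
noncomputable def extendScalarsLinearYonedaObjIso [Module.Flat R X] (Y : ModuleCat.{u} S) :
    P.complex.linearYonedaObj R ((ModuleCat.restrictScalars f).obj Y) ≅
    ((ModuleCat.restrictScalars f).mapHomologicalComplex _).obj
      ((P.extendScalars f).complex.linearYonedaObj S Y) :=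
  HomologicalComplex.Hom.isoOfComponents
    (fun n ↦ (ModuleCat.extendScalarsHomLinearEquiv f (P.complex.X n) Y).symm.toModuleIso)
    fun i j _ ↦ by
      ext g
      exact ((ModuleCat.extendRestrictScalarsAdj f).homEquiv_naturality_left_symm
        (P.complex.d j i) g).symm

/-- Base change for `Ext` out of a flat module. -/
noncomputable def extExtendScalarsIso [Module.Flat R X] (Y : ModuleCat.{u} S) (n : ℕ) :
    ((Ext R (ModuleCat.{u} R) n).obj (Opposite.op X)).obj ((ModuleCat.restrictScalars f).obj Y) ≅
    (ModuleCat.restrictScalars f).obj (((Ext S (ModuleCat.{u} S) n).obj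
      (Opposite.op ((ModuleCat.extendScalars.{u, u, u} f).obj X))).obj Y) :=
  P.isoExt n _ ≪≫ HomologicalComplex.homologyMapIso (P.extendScalarsLinearYonedaObjIso f Y) n ≪≫
    (((P.extendScalars f).complex.linearYonedaObj S Y).sc n).mapHomologyIso
      (ModuleCat.restrictScalars f) ≪≫
    (ModuleCat.restrictScalars f).mapIso ((P.extendScalars f).isoExt n Y).symm

end CategoryTheory.ProjectiveResolution

/-- The `A ⧸ I`-linear isomorphism `(A ⧸ I) ⊗ B ≃ B ⧸ I B`. -/
noncomputable def quotTensorLinearEquiv {A : Type*} [CommRing A] (I : Ideal A) (B : Type*)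
    [AddCommGroup B] [Module A B] :
    TensorProduct A (A ⧸ I) B ≃ₗ[A ⧸ I] B ⧸ (I • (⊤ : Submodule A B)) :=
  (TensorProduct.quotTensorEquivQuotSMul B I).extendScalarsOfSurjective
    Ideal.Quotient.mk_surjective

/-- Let `A` be a commutative ring, `I ⊆ A` an ideal, and `B` a flat `A`-module. Then for every
`A/I`-module `M` (i.e. every `A`-module `M` with `IM = 0`) and every `p ≥ 0` there is an
isomorphism `Ext^p_A(B, M) ≅ Ext^p_{A/I}(B/IB, M)`. -/
theorem ext_iso_ext_quotient_of_flat (A : Type) [CommRing A] (I : Ideal A)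
    (B : Type) [AddCommGroup B] [Module A B] [Module.Flat A B]
    (M : Type) [AddCommGroup M] [Module A M] [Module (A ⧸ I) M] [IsScalarTower A (A ⧸ I) M]
    (p : ℕ) :
    Nonempty
      ((((Ext A (ModuleCat A) p).obj
          (Opposite.op (ModuleCat.of A B))).obj (ModuleCat.of A M)) ≃+
        (((Ext (A ⧸ I) (ModuleCat (A ⧸ I)) p).obj
          (Opposite.op (ModuleCat.of (A ⧸ I) (B ⧸ (I • (⊤ : Submodule A B)))))).obj
          (ModuleCat.of (A ⧸ I) M))) := by
  let f : A →+* A ⧸ I := Ideal.Quotient.mk I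
  let N := (ModuleCat.restrictScalars f).obj (ModuleCat.of (A ⧸ I) M)
  let e : M ≃ₗ[A] N := { AddEquiv.refl M with map_smul' a m := (algebraMap_smul (A ⧸ I) a m).symm }
  let eM : ModuleCat.of A M ≅ N := e.toModuleIso
  let eB : (ModuleCat.extendScalars f).obj (ModuleCat.of A B) ≅
      ModuleCat.of (A ⧸ I) (B ⧸ (I • (⊤ : Submodule A B))) :=
    LinearEquiv.toModuleIso (X₁ := (ModuleCat.extendScalars f).obj (ModuleCat.of A B))
      (quotTensorLinearEquiv I B)
  let e₁ := ((Ext A (ModuleCat A) p).obj (Opposite.op (ModuleCat.of A B))).mapIso eM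
  let e₂ := (ProjectiveResolution.of (ModuleCat.of A B)).extExtendScalarsIso f
    (ModuleCat.of (A ⧸ I) M) p
  let e₃ := ((Ext (A ⧸ I) (ModuleCat (A ⧸ I)) p).mapIso eB.op.symm).app (ModuleCat.of (A ⧸ I) M)
  exact ⟨((e₁ ≪≫ e₂).toLinearEquiv.toAddEquiv).trans e₃.toLinearEquiv.toAddEquiv⟩
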